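/- arXiv:1008.4500 — 2 statements merged into one kernel-verified Lean document; each statement's English description precedes it below -/
import Mathlib

section
/- Let n = (1/3, 1/3, 1/3) ∈ ℝ³. Then B·n = (−1/3, 5/6, 1/6) lies in the Γ-orbit of n, δ·n = (1/3,1/3,1/3) and δ·(B·n) = (−1/3, 1/6, 5/6), yet there is NO γ ∈ Γ with γ·(δ·n) = δ·(B·n). Consequently the assignment Γ·x ↦ Γ·(δ·x) on Γ-orbits in ℝ³ is not well defined, even though conjugation by D is an automorphism of ℝ³⋊F with DΓD⁻¹ ⊆ Γ whose restriction to ℝ³ is x ↦ δ·x. (This is the paper's counterexample to the definition of infra-nilmanifold endomorphism used by Franks and Shub.) -/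
/-- The affine group `Aff(ℝⁿ) = ℝⁿ ⋊ GLₙ(ℝ)`: pairs `(v, M)` with multiplication
`(v, M) * (w, N) = (v + M·w, M·N)`. -/
@[ext] structure AffR (n : ℕ) where
  v : Fin n → ℝ
  m : GL (Fin n) ℝ

namespace AffR

variable {n : ℕ}

instance : Mul (AffR n) := ⟨fun x y => ⟨x.v + x.m.val.mulVec y.v, x.m * y.m⟩⟩
instance : One (AffR n) := ⟨⟨0, 1⟩⟩
instance : Inv (AffR n) := ⟨fun x => ⟨-((x.m⁻¹).val.mulVec x.v), x.m⁻¹⟩⟩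

@[simp] theorem mul_v (x y : AffR n) : (x * y).v = x.v + x.m.val.mulVec y.v := rfl
@[simp] theorem mul_m (x y : AffR n) : (x * y).m = x.m * y.m := rfl
@[simp] theorem one_v : (1 : AffR n).v = 0 := rfl
@[simp] theorem one_m : (1 : AffR n).m = 1 := rfl
@[simp] theorem inv_v (x : AffR n) : (x⁻¹).v = -((x.m⁻¹).val.mulVec x.v) := rfl
@[simp] theorem inv_m (x : AffR n) : (x⁻¹).m = x.m⁻¹ := rfl

instance : Group (AffR n) where
  mul_assoc x y z := by
    ext <;> simp [Matrix.mulVec_add, Matrix.mulVec_mulVec, add_assoc, mul_assoc]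
  one_mul x := by ext <;> simp
  mul_one x := by ext <;> simp
  inv_mul_cancel x := by ext <;> simp

/-- The natural affine action of `Aff(ℝⁿ)` on `ℝⁿ`: `(v, M) · x = v + M·x`. -/
def act (g : AffR n) (x : Fin n → ℝ) : Fin n → ℝ := g.v + g.m.val.mulVec x

/-- The translation by a vector `w`, i.e. the element `(w, I)` of `Aff(ℝⁿ)`. -/
def tr (w : Fin n → ℝ) : AffR n := ⟨w, 1⟩

end AffR

/-- `α₀ = diag(1,−1,−1)` as an element of `GL₃(ℝ)`. -/
noncomputable def alpha0 : GL (Fin 3) ℝ :=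
  ⟨!![1,0,0; 0,-1,0; 0,0,-1], !![1,0,0; 0,-1,0; 0,0,-1],
    by rw [Matrix.mul_fin_three, Matrix.one_fin_three]; norm_num,
    by rw [Matrix.mul_fin_three, Matrix.one_fin_three]; norm_num⟩

/-- `β₀ = diag(−1,1,−1)` as an element of `GL₃(ℝ)`. -/
noncomputable def beta0 : GL (Fin 3) ℝ :=
  ⟨!![-1,0,0; 0,1,0; 0,0,-1], !![-1,0,0; 0,1,0; 0,0,-1],
    by rw [Matrix.mul_fin_three, Matrix.one_fin_three]; norm_num,
    by rw [Matrix.mul_fin_three, Matrix.one_fin_three]; norm_num⟩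

/-- `δ`, the permutation matrix interchanging the 2nd and 3rd coordinates,
as an element of `GL₃(ℝ)`. -/
noncomputable def deltaP : GL (Fin 3) ℝ :=
  ⟨!![1,0,0; 0,0,1; 0,1,0], !![1,0,0; 0,0,1; 0,1,0],
    by rw [Matrix.mul_fin_three, Matrix.one_fin_three]; norm_num,
    by rw [Matrix.mul_fin_three, Matrix.one_fin_three]; norm_num⟩

/-- `A = ((1/2,0,0), α₀) ∈ Aff(ℝ³)`. -/
noncomputable def Ael : AffR 3 := ⟨![1/2, 0, 0], alpha0⟩

/-- `B = ((0,1/2,1/2), β₀) ∈ Aff(ℝ³)`. -/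
noncomputable def Bel : AffR 3 := ⟨![0, 1/2, 1/2], beta0⟩

/-- `D = ((1/4,0,0), δ) ∈ Aff(ℝ³)`. -/
noncomputable def Del : AffR 3 := ⟨![1/4, 0, 0], deltaP⟩

/-- The Hantzsche–Wendt group `Γ`: the subgroup of `Aff(ℝ³)` generated by the integer
translations together with `A` and `B`. -/
noncomputable def GammaHW : Subgroup (AffR 3) :=
  Subgroup.closure
    ({x : AffR 3 | ∃ z : Fin 3 → ℤ, x = AffR.tr fun i => (z i : ℝ)} ∪ {Ael, Bel})

/-- The set `{(0,μ) : μ ∈ F}` in `Aff(ℝ³)`, where `F = {I₃, α₀, β₀, α₀β₀}`. -/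
noncomputable def FSet : Set (AffR 3) :=
  {(⟨0, 1⟩ : AffR 3), ⟨0, alpha0⟩, ⟨0, beta0⟩, ⟨0, alpha0 * beta0⟩}

/-- The subgroup `ℝ³⋊F` of `Aff(ℝ³)`: the subgroup generated by all translations
`{(v,I₃) : v ∈ ℝ³}` together with `{(0,μ) : μ ∈ F}`. -/
noncomputable def R3F : Subgroup (AffR 3) :=
  Subgroup.closure ({x : AffR 3 | x.m = 1} ∪ FSet)

/-- The point `n = (1/3, 1/3, 1/3) ∈ ℝ³`. -/
noncomputable def nPt : Fin 3 → ℝ := ![1/3, 1/3, 1/3]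

namespace AffR

variable {n : ℕ}

theorem act_one (x : Fin n → ℝ) : act 1 x = x := by
  simp [act]

theorem act_mul (g h : AffR n) (x : Fin n → ℝ) : act (g * h) x = act g (act h x) := by
  simp [act, Matrix.mulVec_add, Matrix.mulVec_mulVec, add_assoc]

theorem act_inv_act (g : AffR n) (x : Fin n → ℝ) : act g (act g⁻¹ x) = x := by
  rw [← act_mul, mul_inv_cancel, act_one]

theorem conj_tr (g : AffR n) (w : Fin n → ℝ) : g * tr w * g⁻¹ = tr (g.m.val.mulVec w) := by
  rw [mul_inv_eq_iff_eq_mul]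
  ext <;> simp [tr, add_comm]

end AffR

theorem alpha0_mulVec (x : Fin 3 → ℝ) : alpha0.val.mulVec x = ![x 0, -x 1, -x 2] := by
  ext i
  fin_cases i <;> simp [alpha0, Matrix.mulVec, dotProduct, Fin.sum_univ_three]

theorem beta0_mulVec (x : Fin 3 → ℝ) : beta0.val.mulVec x = ![-x 0, x 1, -x 2] := by
  ext i
  fin_cases i <;> simp [beta0, Matrix.mulVec, dotProduct, Fin.sum_univ_three]

theorem deltaP_mulVec (x : Fin 3 → ℝ) : deltaP.val.mulVec x = ![x 0, x 2, x 1] := by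
  ext i
  fin_cases i <;> simp [deltaP, Matrix.mulVec, dotProduct, Fin.sum_univ_three]

theorem act_Ael (x : Fin 3 → ℝ) : AffR.act Ael x = ![1/2 + x 0, -x 1, -x 2] := by
  simp [AffR.act, Ael, alpha0_mulVec]

theorem act_Bel (x : Fin 3 → ℝ) : AffR.act Bel x = ![-x 0, 1/2 + x 1, 1/2 - x 2] := by
  simp [AffR.act, Bel, beta0_mulVec, sub_eq_add_neg]

/-- The image of the `Γ`-orbit of `n` under the projection to the first two coordinates, scaled
by `6` and reduced modulo `6`. -/
def orbitResidues : Set (ℤ × ℤ) :=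
  {p | (p.1 % 6 = 2 ∧ p.2 % 6 = 2) ∨ (p.1 % 6 = 5 ∧ p.2 % 6 = 4) ∨
    (p.1 % 6 = 4 ∧ p.2 % 6 = 5) ∨ (p.1 % 6 = 1 ∧ p.2 % 6 = 1)}

/-- A `Γ`-invariant set that contains `n`. -/
def orbitHull : Set (Fin 3 → ℝ) :=
  {x | ∃ p ∈ orbitResidues, 6 * x 0 = p.1 ∧ 6 * x 1 = p.2}

theorem act_mem_orbitHull_iff {γ : AffR 3} (hγ : γ ∈ GammaHW) :
    ∀ x, AffR.act γ x ∈ orbitHull ↔ x ∈ orbitHull := by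
  induction hγ using Subgroup.closure_induction with
  | mem γ h =>
    intro x
    rcases h with ⟨z, rfl⟩ | rfl | rfl
    · constructor
      · rintro ⟨⟨k, l⟩, h, h0, h1⟩
        refine ⟨(k - 6 * z 0, l - 6 * z 1), ?_, ?_, ?_⟩
        · simp only [orbitResidues, Set.mem_ofPred_eq] at h ⊢
          omega
        all_goals
          simp [AffR.act, AffR.tr] at h0 h1 ⊢
          linarith
      · rintro ⟨⟨k, l⟩, h, h0, h1⟩
        refine ⟨(k + 6 * z 0, l + 6 * z 1), ?_, ?_, ?_⟩
        · simp only [orbitResidues, Set.mem_ofPred_eq] at h ⊢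
          omega
        all_goals
          simp [AffR.act, AffR.tr] at h0 h1 ⊢
          linarith
    · rw [act_Ael]
      constructor
      · rintro ⟨⟨k, l⟩, h, h0, h1⟩
        refine ⟨(k - 3, -l), ?_, ?_, ?_⟩
        · simp only [orbitResidues, Set.mem_ofPred_eq] at h ⊢
          omega
        all_goals
          simp at h0 h1 ⊢
          linarith
      · rintro ⟨⟨k, l⟩, h, h0, h1⟩
        refine ⟨(k + 3, -l), ?_, ?_, ?_⟩
        · simp only [orbitResidues, Set.mem_ofPred_eq] at h ⊢
          omega
        all_goals
          simp at h0 h1 ⊢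
          linarith
    · rw [act_Bel]
      constructor
      · rintro ⟨⟨k, l⟩, h, h0, h1⟩
        refine ⟨(-k, l - 3), ?_, ?_, ?_⟩
        · simp only [orbitResidues, Set.mem_ofPred_eq] at h ⊢
          omega
        all_goals
          simp at h0 h1 ⊢
          linarith
      · rintro ⟨⟨k, l⟩, h, h0, h1⟩
        refine ⟨(-k, l + 3), ?_, ?_, ?_⟩
        · simp only [orbitResidues, Set.mem_ofPred_eq] at h ⊢
          omega
        all_goals
          simp at h0 h1 ⊢
          linarith
  | one => simp [AffR.act_one]
  | mul g h _ _ hg hh => intro x; rw [AffR.act_mul, hg, hh]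
  | inv g _ hg => intro x; rw [← hg, AffR.act_inv_act]

theorem nPt_mem_orbitHull : nPt ∈ orbitHull :=
  ⟨(2, 2), by simp [orbitResidues], by norm_num [nPt], by norm_num [nPt]⟩

theorem delta_act_Bel_notMem_orbitHull : ![-(1/3), 1/6, 5/6] ∉ orbitHull := by
  rintro ⟨⟨k, l⟩, h, h0, h1⟩
  have hk : k = -2 := by
    have : (k : ℝ) = -2 := by rw [← h0]; norm_num
    exact_mod_cast this
  have hl : l = 1 := by
    have : (l : ℝ) = 1 := by rw [← h1]; norm_num
    exact_mod_cast this
  subst hk hl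
  simp [orbitResidues] at h

theorem deltaP_mul_alpha0 : deltaP * alpha0 = alpha0 * deltaP := by
  ext i j
  fin_cases i <;> fin_cases j <;>
    simp [deltaP, alpha0, Matrix.mul_apply, Fin.sum_univ_three]

theorem deltaP_mul_beta0 : deltaP * beta0 = alpha0 * beta0 * deltaP := by
  ext i j
  fin_cases i <;> fin_cases j <;>
    simp [deltaP, alpha0, beta0, Matrix.mul_apply, Fin.sum_univ_three]

theorem alpha0_mul_self : alpha0 * alpha0 = 1 := by
  ext i j
  fin_cases i <;> fin_cases j <;>
    simp [alpha0, Matrix.mul_apply, Fin.sum_univ_three]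

theorem deltaP_mul_self : deltaP * deltaP = 1 := by
  ext i j
  fin_cases i <;> fin_cases j <;>
    simp [deltaP, Matrix.mul_apply, Fin.sum_univ_three]

theorem mem_R3F_of_m_mem {x : AffR 3}
    (h : x.m = 1 ∨ x.m = alpha0 ∨ x.m = beta0 ∨ x.m = alpha0 * beta0) : x ∈ R3F := by
  have hx : x = AffR.tr x.v * ⟨0, x.m⟩ := by ext <;> simp [AffR.tr]
  rw [hx]
  refine mul_mem (Subgroup.subset_closure (Or.inl rfl)) (Subgroup.subset_closure (Or.inr ?_))
  simpa [FSet] using h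

theorem Del_conj_mem_R3F {x : AffR 3} (hx : x ∈ R3F) : Del * x * Del⁻¹ ∈ R3F := by
  suffices R3F ≤ R3F.comap (MulAut.conj Del).toMonoidHom from this hx
  refine (Subgroup.closure_le _).2 fun x hx => mem_R3F_of_m_mem ?_
  have hm : x.m = 1 ∨ x.m = alpha0 ∨ x.m = beta0 ∨ x.m = alpha0 * beta0 := by
    rcases hx with h | rfl | rfl | rfl | rfl
    · exact Or.inl h
    all_goals simp
  change deltaP * x.m * deltaP⁻¹ = 1 ∨ deltaP * x.m * deltaP⁻¹ = alpha0 ∨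
    deltaP * x.m * deltaP⁻¹ = beta0 ∨ deltaP * x.m * deltaP⁻¹ = alpha0 * beta0
  simp only [mul_inv_eq_iff_eq_mul]
  rcases hm with h | h | h | h <;> rw [h]
  · simp
  · exact Or.inr (Or.inl deltaP_mul_alpha0)
  · exact Or.inr (Or.inr (Or.inr deltaP_mul_beta0))
  · right; right; left
    rw [← mul_assoc, deltaP_mul_alpha0, mul_assoc, deltaP_mul_beta0, ← mul_assoc, ← mul_assoc,
      alpha0_mul_self, one_mul]

theorem Del_mul_self_mem_R3F : Del * Del ∈ R3F :=
  mem_R3F_of_m_mem (Or.inl deltaP_mul_self)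

theorem map_conj_Del_R3F : Subgroup.map (MulAut.conj Del).toMonoidHom R3F = R3F := by
  apply le_antisymm
  · rintro _ ⟨x, hx, rfl⟩
    exact Del_conj_mem_R3F hx
  · intro x hx
    refine ⟨Del * ((Del * Del)⁻¹ * x * (Del * Del)) * Del⁻¹, Del_conj_mem_R3F
      (mul_mem (mul_mem (inv_mem Del_mul_self_mem_R3F) hx) Del_mul_self_mem_R3F), ?_⟩
    simp [mul_assoc]

theorem Ael_mem_GammaHW : Ael ∈ GammaHW := Subgroup.subset_closure (by simp)

theorem Bel_mem_GammaHW : Bel ∈ GammaHW := Subgroup.subset_closure (by simp)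

theorem tr_intCast_mem_GammaHW (z : Fin 3 → ℤ) : AffR.tr (fun i => (z i : ℝ)) ∈ GammaHW :=
  Subgroup.subset_closure (Or.inl ⟨z, rfl⟩)

theorem Del_conj_Ael : Del * Ael * Del⁻¹ = Ael := by
  rw [mul_inv_eq_iff_eq_mul]
  refine AffR.ext ?_ deltaP_mul_alpha0
  simp [Del, Ael, deltaP_mulVec, alpha0_mulVec, add_comm]

theorem Del_conj_Bel :
    Del * Bel * Del⁻¹ = AffR.tr (fun i => ((![0, 1, 1] : Fin 3 → ℤ) i : ℝ)) * (Ael * Bel) := by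
  have hz : (fun i => ((![0, 1, 1] : Fin 3 → ℤ) i : ℝ)) = ![0, 1, 1] := by
    ext i
    fin_cases i <;> simp
  rw [mul_inv_eq_iff_eq_mul, hz]
  refine AffR.ext ?_ ?_
  · ext i
    fin_cases i <;>
      simp [Del, Ael, Bel, AffR.tr, deltaP_mulVec, alpha0_mulVec, beta0_mulVec,
        ← Matrix.mulVec_mulVec] <;>
      norm_num
  · simpa [Del, Ael, Bel, AffR.tr] using deltaP_mul_beta0

theorem Del_conj_mem_GammaHW {γ : AffR 3} (hγ : γ ∈ GammaHW) : Del * γ * Del⁻¹ ∈ GammaHW := by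
  suffices GammaHW ≤ GammaHW.comap (MulAut.conj Del).toMonoidHom from this hγ
  refine (Subgroup.closure_le _).2 fun x hx => ?_
  change Del * x * Del⁻¹ ∈ GammaHW
  rcases hx with ⟨z, rfl⟩ | rfl | rfl
  · have h : Del.m.val.mulVec (fun i => (z i : ℝ)) =
        fun i => ((![z 0, z 2, z 1] : Fin 3 → ℤ) i : ℝ) := by
      rw [show Del.m = deltaP from rfl, deltaP_mulVec]
      ext i
      fin_cases i <;> rfl
    rw [AffR.conj_tr, h]
    exact tr_intCast_mem_GammaHW _
  · rw [Del_conj_Ael]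
    exact Ael_mem_GammaHW
  · rw [Del_conj_Bel]
    exact mul_mem (tr_intCast_mem_GammaHW _) (mul_mem Ael_mem_GammaHW Bel_mem_GammaHW)

/-- the paper's counterexample to the definition of infra-nilmanifold
endomorphism used by Franks and Shub. For `n = (1/3,1/3,1/3)`: `B·n = (−1/3, 5/6, 1/6)`
lies in the `Γ`-orbit of `n`, `δ·n = (1/3,1/3,1/3)` and `δ·(B·n) = (−1/3, 1/6, 5/6)`, yet
there is NO `γ ∈ Γ` with `γ·(δ·n) = δ·(B·n)`. Hence the assignment `Γ·x ↦ Γ·(δ·x)` on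
`Γ`-orbits is not well defined, even though conjugation by `D` is an automorphism of
`ℝ³⋊F` with `DΓD⁻¹ ⊆ Γ` whose restriction to `ℝ³` is `x ↦ δ·x`. -/
theorem orbit_map_not_well_defined :
    AffR.act Bel nPt = ![-(1/3), 5/6, 1/6] ∧
    (∃ γ ∈ GammaHW, AffR.act γ nPt = AffR.act Bel nPt) ∧
    deltaP.val.mulVec nPt = ![1/3, 1/3, 1/3] ∧
    deltaP.val.mulVec (AffR.act Bel nPt) = ![-(1/3), 1/6, 5/6] ∧
    ¬ (∃ γ ∈ GammaHW,
        AffR.act γ (deltaP.val.mulVec nPt) = deltaP.val.mulVec (AffR.act Bel nPt)) ∧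
    (Subgroup.map (MulAut.conj Del).toMonoidHom R3F = R3F ∧
      (∀ γ ∈ GammaHW, Del * γ * Del⁻¹ ∈ GammaHW) ∧
      (∀ x : Fin 3 → ℝ, Del * AffR.tr x * Del⁻¹ = AffR.tr (deltaP.val.mulVec x))) := by
  have hB : AffR.act Bel nPt = ![-(1/3), 5/6, 1/6] := by
    rw [act_Bel]
    ext i
    fin_cases i <;> simp [nPt] <;> norm_num
  have hn : deltaP.val.mulVec nPt = nPt := by
    rw [deltaP_mulVec]
    simp [nPt]
  have hδB : deltaP.val.mulVec (AffR.act Bel nPt) = ![-(1/3), 1/6, 5/6] := by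
    rw [hB, deltaP_mulVec]
    simp
  refine ⟨hB, ⟨Bel, Bel_mem_GammaHW, rfl⟩, hn, hδB, ?_, map_conj_Del_R3F,
    fun _ => Del_conj_mem_GammaHW, AffR.conj_tr Del⟩
  rintro ⟨γ, hγ, h⟩
  rw [hn, hδB] at h
  exact delta_act_Bel_notMem_orbitHull (h ▸ (act_mem_orbitHull_iff hγ nPt).2 nPt_mem_orbitHull)
end

section
/- Let Γ ≤ Aff(ℝ⁴) be the 4-dimensional Bieberbach group and α = ((1/2,1/2,0,0), M) as in the paper's Section 5 example (so α Γ α⁻¹ = Γ). For every group automorphism h of Γ, every φ ∈ GL₄(ℝ) with (0,φ)·Γ·(0,φ)⁻¹ = Γ, and all δ₁, δ₂ ∈ Γ, it is NOT the case that h(δ₁ (α γ α⁻¹) δ₁⁻¹) = δ₂ ((0,φ) h(γ) (0,φ)⁻¹) δ₂⁻¹ for all γ ∈ Γ. (Hence the Anosov diffeomorphism of the flat 4-manifold Γ\ℝ⁴ induced by α is, even up to inner automorphisms of the fundamental group, never conjugate to the automorphism induced by a linear map; this is the group-theoretic core of the paper's counterexample to Manning's claim.) -/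
/-- `L = diag(−1,−1,1,1)` as an element of `GL₄(ℝ)`. -/
noncomputable def LGL : GL (Fin 4) ℝ :=
  ⟨!![-1,0,0,0; 0,-1,0,0; 0,0,1,0; 0,0,0,1], !![-1,0,0,0; 0,-1,0,0; 0,0,1,0; 0,0,0,1],
    by
      ext i j
      fin_cases i <;> fin_cases j <;>
        simp [Matrix.mul_apply, Fin.sum_univ_succ, Matrix.one_apply] <;> norm_num,
    by
      ext i j
      fin_cases i <;> fin_cases j <;>
        simp [Matrix.mul_apply, Fin.sum_univ_succ, Matrix.one_apply] <;> norm_num⟩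

/-- The block-diagonal matrix with two copies of `[[13,8],[8,5]]` on the diagonal,
as an element of `GL₄(ℝ)`. -/
noncomputable def MGL : GL (Fin 4) ℝ :=
  ⟨!![13,8,0,0; 8,5,0,0; 0,0,13,8; 0,0,8,5], !![5,-8,0,0; -8,13,0,0; 0,0,5,-8; 0,0,-8,13],
    by
      ext i j
      fin_cases i <;> fin_cases j <;>
        simp [Matrix.mul_apply, Fin.sum_univ_succ, Matrix.one_apply] <;> norm_num,
    by
      ext i j
      fin_cases i <;> fin_cases j <;>
        simp [Matrix.mul_apply, Fin.sum_univ_succ, Matrix.one_apply] <;> norm_num⟩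

/-- `a`, the translation by `e₁`. -/
noncomputable def a4 : AffR 4 := AffR.tr ![1, 0, 0, 0]

/-- `b`, the translation by `e₂`. -/
noncomputable def b4 : AffR 4 := AffR.tr ![0, 1, 0, 0]

/-- `c`, the translation by `e₃`. -/
noncomputable def c4 : AffR 4 := AffR.tr ![0, 0, 1, 0]

/-- `d`, the translation by `e₄`. -/
noncomputable def d4 : AffR 4 := AffR.tr ![0, 0, 0, 1]

/-- `f = ((0,0,1/2,1/2), L) ∈ Aff(ℝ⁴)`. -/
noncomputable def f4 : AffR 4 := ⟨![0, 0, 1/2, 1/2], LGL⟩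

/-- The 4-dimensional Bieberbach group `Γ ≤ Aff(ℝ⁴)` of the paper's Section 5 example,
generated by `a`, `b`, `c`, `d` and `f`. -/
noncomputable def Gamma4 : Subgroup (AffR 4) := Subgroup.closure {a4, b4, c4, d4, f4}

/-- `α = ((1/2,1/2,0,0), M) ∈ Aff(ℝ⁴)`. -/
noncomputable def alpha4 : AffR 4 := ⟨![1/2, 1/2, 0, 0], MGL⟩

/-- The form of the elements of `Γ`: integral translations, and integral translations
composed with `f`. -/
theorem mem_Gamma4_cases {g : AffR 4} (hg : g ∈ Gamma4) :
    (∃ x y z w : ℤ, g = ⟨![x, y, z, w], 1⟩) ∨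
      ∃ x y z w : ℤ, g = ⟨![x, y, z + 1 / 2, w + 1 / 2], LGL⟩ := by
  have hLL : LGL * LGL = 1 := Units.ext LGL.val_inv
  have hLi : LGL⁻¹ = LGL := inv_eq_of_mul_eq_one_left hLL
  induction hg using Subgroup.closure_induction with
  | mem g hg =>
    simp only [Set.mem_insert_iff, Set.mem_singleton_iff] at hg
    rcases hg with rfl | rfl | rfl | rfl | rfl
    · exact Or.inl ⟨1, 0, 0, 0, by simp [a4, AffR.tr]⟩
    · exact Or.inl ⟨0, 1, 0, 0, by simp [b4, AffR.tr]⟩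
    · exact Or.inl ⟨0, 0, 1, 0, by simp [c4, AffR.tr]⟩
    · exact Or.inl ⟨0, 0, 0, 1, by simp [d4, AffR.tr]⟩
    · exact Or.inr ⟨0, 0, 0, 0, by simp [f4]⟩
  | one =>
    refine Or.inl ⟨0, 0, 0, 0, AffR.ext ?_ rfl⟩
    ext i; fin_cases i <;> simp
  | mul g k _ _ hg hk =>
    rcases hg with ⟨x, y, z, w, rfl⟩ | ⟨x, y, z, w, rfl⟩ <;>
      rcases hk with ⟨x', y', z', w', rfl⟩ | ⟨x', y', z', w', rfl⟩
    · refine Or.inl ⟨x + x', y + y', z + z', w + w', AffR.ext ?_ (by simp)⟩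
      ext i; fin_cases i <;> simp
    · refine Or.inr ⟨x + x', y + y', z + z', w + w', AffR.ext ?_ (by simp)⟩
      ext i; fin_cases i <;> simp <;> ring
    · refine Or.inr ⟨x - x', y - y', z + z', w + w', AffR.ext ?_ (by simp)⟩
      ext i; fin_cases i <;> simp [LGL] <;> ring
    · refine Or.inl ⟨x - x', y - y', z + z' + 1, w + w' + 1, AffR.ext ?_ (by simp [hLL])⟩
      ext i; fin_cases i <;> simp [LGL] <;> ring
  | inv g _ hg =>
    rcases hg with ⟨x, y, z, w, rfl⟩ | ⟨x, y, z, w, rfl⟩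
    · refine Or.inl ⟨-x, -y, -z, -w, AffR.ext ?_ (by simp)⟩
      ext i; fin_cases i <;> simp
    · refine Or.inr ⟨x, y, -z - 1, -w - 1, AffR.ext ?_ (by simp [hLi])⟩
      ext i; fin_cases i <;>
        simp [hLi] <;> simp [LGL] <;> ring

theorem AffR.tr_mul {n : ℕ} (x y : Fin n → ℝ) : AffR.tr x * AffR.tr y = AffR.tr (x + y) :=
  AffR.ext (by simp [AffR.tr]) (by simp [AffR.tr])

theorem AffR.tr_zpow {n : ℕ} (x : Fin n → ℝ) (k : ℤ) :
    AffR.tr x ^ k = AffR.tr ((k : ℝ) • x) := by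
  let T : Multiplicative (Fin n → ℝ) →* AffR n :=
    MonoidHom.mk' (fun x => AffR.tr x.toAdd) fun x y => (AffR.tr_mul _ _).symm
  have := map_zpow T (Multiplicative.ofAdd x) k
  rw [← ofAdd_zsmul, ← Int.cast_smul_eq_zsmul ℝ] at this
  exact this.symm

/-- Integral translations belong to `Γ`. -/
theorem tr_mem_Gamma4 (x y z w : ℤ) : AffR.tr ![(x : ℝ), y, z, w] ∈ Gamma4 := by
  have key : AffR.tr ![(x : ℝ), y, z, w] = a4 ^ x * b4 ^ y * c4 ^ z * d4 ^ w := by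
    simp only [a4, b4, c4, d4, AffR.tr_zpow, AffR.tr_mul]
    congr 1
    ext i; fin_cases i <;> simp
  have gen : ∀ g ∈ ({a4, b4, c4, d4, f4} : Set (AffR 4)), g ∈ Gamma4 :=
    fun g hg => Subgroup.subset_closure hg
  rw [key]
  exact mul_mem (mul_mem (mul_mem (zpow_mem (gen _ (by simp)) _) (zpow_mem (gen _ (by simp)) _))
    (zpow_mem (gen _ (by simp)) _)) (zpow_mem (gen _ (by simp)) _)

theorem f4_mem_Gamma4 : f4 ∈ Gamma4 := Subgroup.subset_closure (by simp)

/-- The integral translation by `(x, y, z, w)`, as an element of `Γ`. -/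
noncomputable def gammaTr (x y z w : ℤ) : ↥Gamma4 := ⟨AffR.tr ![x, y, z, w], tr_mem_Gamma4 x y z w⟩

theorem gammaTr_mul (x y z w x' y' z' w' : ℤ) :
    gammaTr x y z w * gammaTr x' y' z' w' = gammaTr (x + x') (y + y') (z + z') (w + w') := by
  refine Subtype.ext ((AffR.tr_mul _ _).trans ?_)
  simp [gammaTr]

theorem gammaTr_injective {x y z w x' y' z' w' : ℤ}
    (h : gammaTr x y z w = gammaTr x' y' z' w') : x = x' ∧ y = y' ∧ z = z' ∧ w = w' := by
  have := congrArg (fun g : ↥Gamma4 => (g : AffR 4).v) h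
  simpa [gammaTr, AffR.tr] using this

/-- The third and fourth coordinates are additive on `Γ`, the first two are so modulo `2`. -/
theorem Gamma4_mul_v (g k : ↥Gamma4) :
    (∀ i : Fin 4, i = 0 ∨ i = 1 → ∃ n : ℤ,
      (g * k : AffR 4).v i = (g : AffR 4).v i + (k : AffR 4).v i + n * 2) ∧
    ∀ i : Fin 4, i = 2 ∨ i = 3 → (g * k : AffR 4).v i = (g : AffR 4).v i + (k : AffR 4).v i := by
  obtain ⟨g, hg⟩ := g
  obtain ⟨k, hk⟩ := k
  dsimp only
  have hki : ∃ x y : ℤ, k.v 0 = x ∧ k.v 1 = y := by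
    rcases mem_Gamma4_cases hk with ⟨x, y, z, w, rfl⟩ | ⟨x, y, z, w, rfl⟩ <;>
      exact ⟨x, y, rfl, rfl⟩
  obtain ⟨x, y, hx, hy⟩ := hki
  rcases mem_Gamma4_cases hg with ⟨_, _, _, _, rfl⟩ | ⟨_, _, _, _, rfl⟩
  · refine ⟨fun i _ => ⟨0, by simp⟩, fun i _ => by simp⟩
  · constructor
    · rintro i (rfl | rfl)
      · exact ⟨-x, by simp [LGL, dotProduct, Fin.sum_univ_succ, hx]; ring⟩
      · exact ⟨-y, by simp [LGL, dotProduct, Fin.sum_univ_succ, hy]; ring⟩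
    · rintro i (rfl | rfl) <;> simp [LGL, dotProduct, Fin.sum_univ_succ]

theorem AddCircle.coe_eq_coe_iff_exists {p x y : ℝ} :
    (x : AddCircle p) = y ↔ ∃ n : ℤ, x = y + n * p := by
  rw [← sub_eq_zero, ← AddCircle.coe_sub, AddCircle.coe_eq_zero_iff]
  refine exists_congr fun n => ?_
  rw [zsmul_eq_mul]
  constructor <;> intro h <;> linarith

/-- The parity of the first or second coordinate, a homomorphism on `Γ`. -/
noncomputable def parity (i : Fin 4) (hi : i = 0 ∨ i = 1) :
    ↥Gamma4 →* Multiplicative (AddCircle (2 : ℝ)) :=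
  MonoidHom.mk' (fun g => Multiplicative.ofAdd (((g : AffR 4).v i : ℝ) : AddCircle (2 : ℝ)))
    fun g k => by
      rw [← ofAdd_add, ← AddCircle.coe_add]
      exact congrArg _ (AddCircle.coe_eq_coe_iff_exists.2 ((Gamma4_mul_v g k).1 i hi))

theorem parity_eq_iff {i : Fin 4} (hi : i = 0 ∨ i = 1) (g k : ↥Gamma4) :
    parity i hi g = parity i hi k ↔ ∃ n : ℤ, (g : AffR 4).v i = (k : AffR 4).v i + n * 2 := by
  rw [← AddCircle.coe_eq_coe_iff_exists]
  exact Multiplicative.ofAdd.injective.eq_iff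

theorem parity_sq {i : Fin 4} (hi : i = 0 ∨ i = 1) (g : ↥Gamma4) : parity i hi (g ^ 2) = 1 := by
  rw [← map_one (parity i hi), pow_two, parity_eq_iff]
  obtain ⟨n, hn⟩ := (Gamma4_mul_v g g).1 i hi
  have hg : ∃ x : ℤ, (g : AffR 4).v i = x := by
    rcases mem_Gamma4_cases g.2 with ⟨x, y, z, w, e⟩ | ⟨x, y, z, w, e⟩ <;> rw [e] <;>
      rcases hi with rfl | rfl
    exacts [⟨x, rfl⟩, ⟨y, rfl⟩, ⟨x, rfl⟩, ⟨y, rfl⟩]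
  obtain ⟨x, hx⟩ := hg
  refine ⟨x + n, ?_⟩
  push_cast
  rw [hn, hx]
  simp
  ring

/-- The elements of `Γ` conjugate to their inverse are the translations by
integral vectors of the first coordinate plane. -/
theorem exists_conj_eq_inv_iff (g : ↥Gamma4) :
    (∃ δ : ↥Gamma4, δ * g * δ⁻¹ = g⁻¹) ↔ ∃ x y : ℤ, g = gammaTr x y 0 0 := by
  constructor
  · rintro ⟨δ, hδ⟩
    have h1 : δ * g = g⁻¹ * δ := by rw [← hδ]; group
    have key : ∀ i : Fin 4, i = 2 ∨ i = 3 → (g : AffR 4).v i = 0 := by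
      intro i hi
      have e1 := (Gamma4_mul_v δ g).2 i hi
      have e2 := (Gamma4_mul_v g⁻¹ δ).2 i hi
      have e3 := (Gamma4_mul_v g⁻¹ g).2 i hi
      have e4 : ((δ : AffR 4) * g).v i = (((g⁻¹ : ↥Gamma4) : AffR 4) * δ).v i :=
        congrArg (fun k : ↥Gamma4 => (k : AffR 4).v i) h1
      have e5 : (((g⁻¹ : ↥Gamma4) : AffR 4) * g).v i = 0 := by simp
      linarith
    have k2 := key 2 (Or.inl rfl)
    have k3 := key 3 (Or.inr rfl)
    rcases mem_Gamma4_cases g.2 with ⟨x, y, z, w, e⟩ | ⟨x, y, z, w, e⟩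
    · rw [e] at k2 k3
      obtain rfl : z = 0 := by simpa using k2
      obtain rfl : w = 0 := by simpa using k3
      exact ⟨x, y, Subtype.ext e⟩
    · rw [e] at k2
      have : ((2 * z + 1 : ℤ) : ℝ) = 0 := by
        push_cast
        have : (z : ℝ) + 1 / 2 = 0 := k2
        linarith
      have : 2 * z + 1 = 0 := by exact_mod_cast this
      omega
  · rintro ⟨x, y, rfl⟩
    refine ⟨⟨f4, f4_mem_Gamma4⟩, ?_⟩
    rw [mul_inv_eq_iff_eq_mul]
    refine Subtype.ext (AffR.ext ?_ (by simp [gammaTr, f4, AffR.tr]))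
    ext i; fin_cases i <;>
      simp [gammaTr, f4, AffR.tr, LGL]

theorem exists_map_gammaTr_eq (h : ↥Gamma4 ≃* ↥Gamma4) (x y : ℤ) :
    ∃ x' y' : ℤ, h (gammaTr x y 0 0) = gammaTr x' y' 0 0 := by
  obtain ⟨δ, hδ⟩ := (exists_conj_eq_inv_iff _).2 ⟨x, y, rfl⟩
  exact (exists_conj_eq_inv_iff _).1 ⟨h δ, by rw [← map_inv, ← map_mul, ← map_mul, hδ, map_inv]⟩

theorem parity_conj {i : Fin 4} (hi : i = 0 ∨ i = 1) (δ g : ↥Gamma4) :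
    parity i hi (δ * g * δ⁻¹) = parity i hi g := by
  rw [map_mul, map_mul, map_inv, mul_comm, inv_mul_cancel_left]

theorem alpha4_conj_gammaTr (x y : ℤ) :
    ((gammaTr x y 0 0 * gammaTr (6 * x + 4 * y) (4 * x + 2 * y) 0 0 ^ 2 : ↥Gamma4) : AffR 4) =
      alpha4 * (gammaTr x y 0 0 : AffR 4) * alpha4⁻¹ := by
  rw [eq_mul_inv_iff_mul_eq, pow_two, gammaTr_mul, gammaTr_mul]
  refine AffR.ext ?_ (by simp [gammaTr, alpha4, AffR.tr])
  ext i; fin_cases i <;>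
    simp [gammaTr, alpha4, AffR.tr, MGL] <;> ring

theorem alpha4_conj_f4 :
    ((gammaTr 1 1 0 0 * gammaTr 0 0 5 3 ^ 2 * ⟨f4, f4_mem_Gamma4⟩ : ↥Gamma4) : AffR 4) =
      alpha4 * f4 * alpha4⁻¹ := by
  have hML : LGL * MGL = MGL * LGL := by
    ext i j
    fin_cases i <;> fin_cases j <;> simp [LGL, MGL, Matrix.mul_apply, Fin.sum_univ_succ]
  rw [eq_mul_inv_iff_mul_eq, pow_two, gammaTr_mul, gammaTr_mul]
  refine AffR.ext ?_ (by simp [gammaTr, alpha4, f4, AffR.tr, hML])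
  ext i; fin_cases i <;>
    simp [gammaTr, alpha4, f4, AffR.tr, MGL, LGL] <;>
    norm_num

/-- The automorphism of `Γ` given by conjugation by an affine map normalizing `Γ`. -/
noncomputable def conjGamma (β : AffR 4)
    (hβ : Subgroup.map (MulAut.conj β).toMonoidHom Gamma4 = Gamma4) : ↥Gamma4 ≃* ↥Gamma4 :=
  ((MulAut.conj β).subgroupMap Gamma4).trans (MulEquiv.subgroupCongr hβ)

theorem coe_conjGamma (β : AffR 4)
    (hβ : Subgroup.map (MulAut.conj β).toMonoidHom Gamma4 = Gamma4) (g : ↥Gamma4) :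
    (conjGamma β hβ g : AffR 4) = β * g * β⁻¹ := rfl

theorem linear_conj_v (phi : GL (Fin 4) ℝ) (g : AffR 4) :
    ((⟨0, phi⟩ : AffR 4) * g * (⟨0, phi⟩ : AffR 4)⁻¹).v = phi.val.mulVec g.v := by
  simp

/-- A linear map normalizing `Γ` commutes with the holonomy `L`. -/
theorem commute_LGL (phi : GL (Fin 4) ℝ)
    (hconj : Subgroup.map (MulAut.conj (⟨0, phi⟩ : AffR 4)).toMonoidHom Gamma4 = Gamma4) :
    phi * LGL = LGL * phi := by
  have hm : ((conjGamma _ hconj ⟨f4, f4_mem_Gamma4⟩ : ↥Gamma4) : AffR 4).m = phi * LGL * phi⁻¹ := rfl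
  rcases mem_Gamma4_cases (conjGamma _ hconj ⟨f4, f4_mem_Gamma4⟩).2 with
    ⟨_, _, _, _, e⟩ | ⟨_, _, _, _, e⟩
  · rw [e] at hm
    have : LGL = 1 := (conj_eq_one_iff (a := phi)).1 hm.symm
    have := congrArg (fun A : GL (Fin 4) ℝ => A.val 0 0) this
    norm_num [LGL] at this
  · rw [e] at hm
    exact (eq_mul_inv_iff_mul_eq.1 hm).symm

/-- If conjugation by the linear map `φ` preserves parities of translations in the first
coordinate plane, then it preserves all parities. -/
theorem parity_linear_conj (phi : GL (Fin 4) ℝ)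
    (hconj : Subgroup.map (MulAut.conj (⟨0, phi⟩ : AffR 4)).toMonoidHom Gamma4 = Gamma4)
    {i : Fin 4} (hi : i = 0 ∨ i = 1)
    (htr : ∀ x y : ℤ, parity i hi (conjGamma _ hconj (gammaTr x y 0 0)) =
      parity i hi (gammaTr x y 0 0)) (g : ↥Gamma4) :
    parity i hi (conjGamma _ hconj g) = parity i hi g := by
  have hL := commute_LGL phi hconj
  have hB : ∀ j : Fin 4, j = 2 ∨ j = 3 → phi.val i j = 0 := by
    intro j hj
    have := congrArg (fun A : GL (Fin 4) ℝ => A.val i j) hL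
    rcases hi with rfl | rfl <;> rcases hj with rfl | rfl <;>
      simp [LGL, Matrix.mul_apply, Fin.sum_univ_succ] at this <;> linarith
  have hg : ∃ x y : ℤ, (g : AffR 4).v 0 = x ∧ (g : AffR 4).v 1 = y := by
    rcases mem_Gamma4_cases g.2 with ⟨x, y, z, w, e⟩ | ⟨x, y, z, w, e⟩ <;> rw [e] <;>
      exact ⟨x, y, rfl, rfl⟩
  obtain ⟨x, y, hx, hy⟩ := hg
  have h1 : (g : AffR 4).v i = (gammaTr x y 0 0 : AffR 4).v i := by
    rcases hi with rfl | rfl <;> simp [gammaTr, AffR.tr, hx, hy]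
  have h2 : (conjGamma _ hconj g : AffR 4).v i =
      (conjGamma _ hconj (gammaTr x y 0 0) : AffR 4).v i := by
    rw [coe_conjGamma, coe_conjGamma, linear_conj_v, linear_conj_v]
    simp [Matrix.mulVec, dotProduct, Fin.sum_univ_four, hB 2, hB 3, hx, hy, gammaTr, AffR.tr]
  calc parity i hi (conjGamma _ hconj g)
      = parity i hi (conjGamma _ hconj (gammaTr x y 0 0)) :=
        (parity_eq_iff hi _ _).2 ⟨0, by rw [h2]; simp⟩
    _ = parity i hi (gammaTr x y 0 0) := htr x y
    _ = parity i hi g := (parity_eq_iff hi _ _).2 ⟨0, by rw [h1]; simp⟩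

/-- group-theoretic core of the paper's counterexample to Manning's
claim. For every automorphism `h` of `Γ`, every `φ ∈ GL₄(ℝ)` with `(0,φ)·Γ·(0,φ)⁻¹ = Γ`,
and all `δ₁, δ₂ ∈ Γ`, it is NOT the case that
`h(δ₁ (α γ α⁻¹) δ₁⁻¹) = δ₂ ((0,φ) h(γ) (0,φ)⁻¹) δ₂⁻¹` for all `γ ∈ Γ`.
(Here `γ'` ranges over the elements of `Γ` whose image in `Aff(ℝ⁴)` is `α γ α⁻¹`;
recall `α Γ α⁻¹ = Γ`.) -/
theorem bieberbach4_anosov_not_conjugate_to_linear (h : ↥Gamma4 ≃* ↥Gamma4)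
    (phi : GL (Fin 4) ℝ)
    (hconj : Subgroup.map (MulAut.conj (⟨0, phi⟩ : AffR 4)).toMonoidHom Gamma4 = Gamma4)
    (δ₁ δ₂ : ↥Gamma4) :
    ¬ ∀ (γ γ' : ↥Gamma4), (γ' : AffR 4) = alpha4 * (γ : AffR 4) * alpha4⁻¹ →
        ((h (δ₁ * γ' * δ₁⁻¹) : ↥Gamma4) : AffR 4) =
          (δ₂ : AffR 4) *
            ((⟨0, phi⟩ : AffR 4) * ((h γ : ↥Gamma4) : AffR 4) * (⟨0, phi⟩ : AffR 4)⁻¹) *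
              (δ₂ : AffR 4)⁻¹ := by
  intro H
  have key : ∀ (i : Fin 4) (hi : i = 0 ∨ i = 1) (γ γ' : ↥Gamma4),
      (γ' : AffR 4) = alpha4 * (γ : AffR 4) * alpha4⁻¹ →
        parity i hi (h γ') = parity i hi (conjGamma _ hconj (h γ)) := by
    intro i hi γ γ' hγ
    have e : h (δ₁ * γ' * δ₁⁻¹) = δ₂ * conjGamma _ hconj (h γ) * δ₂⁻¹ :=
      Subtype.ext (H γ γ' hγ)
    rw [← parity_conj hi δ₂ (conjGamma _ hconj (h γ)), ← e, map_mul h, map_mul h,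
      map_inv h, parity_conj]
  have htr : ∀ (i : Fin 4) (hi : i = 0 ∨ i = 1) (x y : ℤ),
      parity i hi (conjGamma _ hconj (gammaTr x y 0 0)) = parity i hi (gammaTr x y 0 0) := by
    intro i hi x y
    obtain ⟨x', y', e⟩ := exists_map_gammaTr_eq h.symm x y
    have := key i hi _ _ (alpha4_conj_gammaTr x' y')
    rw [← e, map_mul, map_pow, map_mul, parity_sq, mul_one, h.apply_symm_apply] at this
    exact this.symm
  obtain ⟨x, y, e⟩ := exists_map_gammaTr_eq h 1 1
  have heven : ∀ (i : Fin 4) (hi : i = 0 ∨ i = 1), parity i hi (gammaTr x y 0 0) = 1 := by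
    intro i hi
    have := key i hi ⟨f4, f4_mem_Gamma4⟩ _ alpha4_conj_f4
    rw [parity_linear_conj phi hconj hi (htr i hi), map_mul, map_mul, map_mul, map_mul, map_pow,
      parity_sq, mul_one, e] at this
    exact mul_eq_right.1 this
  have hcoord : (∃ k : ℤ, x = k + k) ∧ ∃ l : ℤ, y = l + l := by
    constructor
    · obtain ⟨k, hk⟩ := (parity_eq_iff (Or.inl rfl) _ 1).1 (heven 0 (Or.inl rfl))
      refine ⟨k, ?_⟩
      have : (x : ℝ) = k * 2 := by simpa [gammaTr, AffR.tr] using hk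
      rw [← mul_two]
      exact_mod_cast this
    · obtain ⟨k, hk⟩ := (parity_eq_iff (Or.inr rfl) _ 1).1 (heven 1 (Or.inr rfl))
      refine ⟨k, ?_⟩
      have : (y : ℝ) = k * 2 := by simpa [gammaTr, AffR.tr] using hk
      rw [← mul_two]
      exact_mod_cast this
  obtain ⟨⟨k, rfl⟩, l, rfl⟩ := hcoord
  obtain ⟨m, n, e'⟩ := exists_map_gammaTr_eq h.symm k l
  have e2 : gammaTr 1 1 0 0 = gammaTr (m + m) (n + n) (0 + 0) (0 + 0) := by
    rw [← gammaTr_mul, ← e', ← map_mul, gammaTr_mul, MulEquiv.eq_symm_apply, e]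
    rfl
  have := (gammaTr_injective e2).1
  omega
end
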